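/- Under Assumption 1, the family of Markov chains {P^ε}, ε ∈ (0,1/2], induced by PHPIP with κ ∈ (0,1/2] applied to the constrained strategic game Γ is a regular perturbation of the unperturbed chain {P^0}: (A1) {P^ε} is irreducible and aperiodic for all ε ∈ (0,1/2]; (A2) lim_{ε→0} P^ε_{z^1 z^2} = P^0_{z^1 z^2} for all states z^1, z^2 ∈ B; (A3) whenever P^ε_{z^1 z^2} > 0 for some ε, there exists a real number χ(z^1→z^2) ≥ 0 such that lim_{ε→0} P^ε_{z^1 z^2} / ε^{χ(z^1→z^2)} ∈ (0,∞). -/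

import Mathlib

open Filter Topology Set

attribute [local instance] Classical.propDecidable

section PHPIP

variable {ι : Type*} [Fintype ι] [DecidableEq ι] {A : ι → Type*} [∀ i, Fintype (A i)]

/-- Assumption 1 on the constraint maps. -/
def Assumption1 (C : ∀ i, A i → Finset (A i)) : Prop :=
  (∀ (i : ι) (a b : A i), b ∈ C i a ↔ a ∈ C i b) ∧
  (∀ (i : ι) (a b : A i), ∃ (nf : ℕ) (f : ℕ → A i), f 0 = a ∧ f nf = b ∧
      ∀ k < nf, f (k + 1) ∈ C i (f k)) ∧
  (∀ (i : ι) (a : A i), 3 ≤ (C i a).card)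

/-- Assumption 3: unilateral constrained deviations change the utility by less than 1/2. -/
def Assumption3 (U : ι → (∀ i, A i) → ℝ) (C : ∀ i, A i → Finset (A i)) : Prop :=
  ∀ (i : ι) (a : ∀ j, A j) (b : A i), b ∈ C i (a i) →
    U i (Function.update a i b) - U i a < 1 / 2

/-- Γ is a constrained potential game with potential function φ. -/
def IsPotentialGame (U : ι → (∀ i, A i) → ℝ) (C : ∀ i, A i → Finset (A i))
    (φ : (∀ i, A i) → ℝ) : Prop :=
  ∀ (i : ι) (a : ∀ j, A j) (b : A i), b ∈ C i (a i) →
    U i (Function.update a i b) - U i a = φ (Function.update a i b) - φ a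

/-- Probability that, from state `(a0, a1)`, player `i` selects the action `x`
under the PHPIP selection rule with exploration rate `ε` and parameter `κ`. -/
noncomputable def selProb (κ : ℝ) (U : ι → (∀ i, A i) → ℝ)
    (C : ∀ i, A i → Finset (A i)) (ε : ℝ) (a0 a1 : ∀ i, A i) (i : ι) (x : A i) : ℝ :=
  if U i a0 ≤ U i a1 then
    (if x = a1 i then 1 - ε else 0) +
      (if x ∈ (C i (a1 i)).erase (a1 i) then
        ε / ((C i (a1 i)).erase (a1 i)).card else 0)
  else
    (if x = a1 i then (1 - ε) * (κ * ε ^ (U i a0 - U i a1)) else 0) +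
      (if x = a0 i then (1 - ε) * (1 - κ * ε ^ (U i a0 - U i a1)) else 0) +
      (if x ∈ ((C i (a1 i)).erase (a1 i)).erase (a0 i) then
        ε / (((C i (a1 i)).erase (a1 i)).erase (a0 i)).card else 0)

/-- One-step transition probability of the Markov chain `{P^ε}` induced by PHPIP
on pairs of joint actions. -/
noncomputable def phTrans (κ : ℝ) (U : ι → (∀ i, A i) → ℝ)
    (C : ∀ i, A i → Finset (A i)) (ε : ℝ)
    (z1 z2 : (∀ i, A i) × (∀ i, A i)) : ℝ :=
  if z2.1 = z1.2 then ∏ i, selProb κ U C ε z1.1 z1.2 i (z2.2 i) else 0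

/-- The state space B. -/
def memB (C : ∀ i, A i → Finset (A i)) (z : (∀ i, A i) × (∀ i, A i)) : Prop :=
  ∀ i, z.2 i ∈ C i (z.1 i)

/-- k-step transition probabilities of the homogeneous chain `{P^ε}`. -/
noncomputable def phTransPow (κ : ℝ) (U : ι → (∀ i, A i) → ℝ)
    (C : ∀ i, A i → Finset (A i)) (ε : ℝ) :
    ℕ → (∀ i, A i) × (∀ i, A i) → (∀ i, A i) × (∀ i, A i) → ℝ
  | 0, z, z' => if z = z' then 1 else 0
  | k + 1, z, z' => ∑ w : (∀ i, A i) × (∀ i, A i),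
      phTrans κ U C ε z w * phTransPow κ U C ε k w z'

/-- Probability of a path (sequence of states) of the chain `{P^ε}`. -/
noncomputable def pathProb (κ : ℝ) (U : ι → (∀ i, A i) → ℝ)
    (C : ∀ i, A i → Finset (A i)) (ε : ℝ) :
    List ((∀ i, A i) × (∀ i, A i)) → ℝ
  | [] => 1
  | [_] => 1
  | z :: z' :: rest => phTrans κ U C ε z z' * pathProb κ U C ε (z' :: rest)

/-- A transition is feasible if it has positive probability for some ε ∈ (0,1/2]. -/
def Feasible (κ : ℝ) (U : ι → (∀ i, A i) → ℝ) (C : ∀ i, A i → Finset (A i))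
    (z z' : (∀ i, A i) × (∀ i, A i)) : Prop :=
  ∃ ε : ℝ, 0 < ε ∧ ε ≤ 1 / 2 ∧ 0 < phTrans κ U C ε z z'

/-- `l` is a (feasible) path of the chain from `z1` to `z2`. -/
def IsPath (κ : ℝ) (U : ι → (∀ i, A i) → ℝ) (C : ∀ i, A i → Finset (A i))
    (z1 z2 : (∀ i, A i) × (∀ i, A i)) (l : List ((∀ i, A i) × (∀ i, A i))) : Prop :=
  l.head? = some z1 ∧ l.getLast? = some z2 ∧ l.Chain' (Feasible κ U C)

/-- `r` is the resistance of the path `l`:  `lim_{ε→0+} P^ε(l)/ε^r ∈ (0,∞)`. -/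
def IsPathRes (κ : ℝ) (U : ι → (∀ i, A i) → ℝ) (C : ∀ i, A i → Finset (A i))
    (l : List ((∀ i, A i) × (∀ i, A i))) (r : ℝ) : Prop :=
  ∃ L : ℝ, 0 < L ∧
    Tendsto (fun ε : ℝ => pathProb κ U C ε l / ε ^ r) (𝓝[>] (0 : ℝ)) (𝓝 L)

/-- `(a, b)` (as diagonal states `((a,a),(b,b))`) is a pair in `E_s`:
exactly one player deviates and the deviation is feasible. -/
def EsPair (C : ∀ i, A i → Finset (A i)) (a b : ∀ i, A i) : Prop :=
  (∃! i, a i ≠ b i) ∧ ∀ i, a i ≠ b i → b i ∈ C i (a i)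

/-- The path (list of states) of the M-straight-route through the given diagonal nodes. -/
def msrPath : List (∀ i, A i) → List ((∀ i, A i) × (∀ i, A i))
  | [] => []
  | [a] => [(a, a)]
  | a :: b :: rest => (a, a) :: (a, b) :: msrPath (b :: rest)

/-- Weight of the edge of the graph `G_R` from `z` to `z'`: the minimal resistance
among all paths of `{P^ε}` from `z` to `z'`. -/
noncomputable def edgeWeight (κ : ℝ) (U : ι → (∀ i, A i) → ℝ)
    (C : ∀ i, A i → Finset (A i)) (z z' : (∀ i, A i) × (∀ i, A i)) : ℝ :=
  sInf {r : ℝ | ∃ l, IsPath κ U C z z' l ∧ IsPathRes κ U C l r}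

/-- `y` is reachable from `x` in at most `d` constraint-feasible steps. -/
def ReachIn (C : ∀ i, A i → Finset (A i)) (i : ι) : ℕ → A i → A i → Prop
  | 0, x, y => x = y
  | d + 1, x, y => ReachIn C i d x y ∨ ∃ w, ReachIn C i d x w ∧ y ∈ C i w

/-- Inhomogeneous products: `transProd κ U C εs k0 m` is the transition matrix
`P(k0, k0 + m) = ∏_{k'=k0}^{k0+m-1} P_{k'}` of the PIPIP chain with exploration
rates `εs`. -/
noncomputable def transProd (κ : ℝ) (U : ι → (∀ i, A i) → ℝ)
    (C : ∀ i, A i → Finset (A i)) (εs : ℕ → ℝ) (k0 : ℕ) :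
    ℕ → (∀ i, A i) × (∀ i, A i) → (∀ i, A i) × (∀ i, A i) → ℝ
  | 0, z, z' => if z = z' then 1 else 0
  | m + 1, z, z' => ∑ w : (∀ i, A i) × (∀ i, A i),
      transProd κ U C εs k0 m z w * phTrans κ U C (εs (k0 + m)) w z'

/-- The PIPIP exploration rate `ε(k) = k^{-1/(n(D+1))}`. -/
noncomputable def pipipRate (n D : ℕ) (k : ℕ) : ℝ :=
  (k : ℝ) ^ (-(1 : ℝ) / ((n : ℝ) * ((D : ℝ) + 1)))

/-- Accessibility along the unperturbed chain `{P^0}`. -/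
def Accessible0 (κ : ℝ) (U : ι → (∀ i, A i) → ℝ) (C : ∀ i, A i → Finset (A i))
    (z z' : (∀ i, A i) × (∀ i, A i)) : Prop :=
  ∃ k : ℕ, 0 < phTransPow κ U C 0 k z z'

/-- A recurrent communication class of the unperturbed chain `{P^0}`. -/
def IsRecClass (κ : ℝ) (U : ι → (∀ i, A i) → ℝ) (C : ∀ i, A i → Finset (A i))
    (H : Set ((∀ i, A i) × (∀ i, A i))) : Prop :=
  H.Nonempty ∧ (∀ z ∈ H, ∀ z' ∈ H, Accessible0 κ U C z z') ∧
    (∀ z ∈ H, ∀ z', Accessible0 κ U C z z' → z' ∈ H)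

end PHPIP

section RegularPerturbation

variable {ι : Type*} {A : ι → Type*}
  {κ ε : ℝ} {U : ι → (∀ i, A i) → ℝ} {C : ∀ i, A i → Finset (A i)}

theorem mul_rpow_lt_one {δ : ℝ} (hκ0 : 0 < κ) (hκ : κ ≤ 1 / 2) (hε0 : 0 < ε) (hε : ε ≤ 1 / 2)
    (hδ : 0 ≤ δ) : κ * ε ^ δ < 1 := by
  have h1 : ε ^ δ ≤ 1 := Real.rpow_le_one hε0.le (by linarith) hδ
  nlinarith

theorem selProb_nonneg (hκ0 : 0 < κ) (hκ : κ ≤ 1 / 2) (hε0 : 0 < ε) (hε : ε ≤ 1 / 2)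
    (a0 a1 : ∀ i, A i) (i : ι) (x : A i) : 0 ≤ selProb κ U C ε a0 a1 i x := by
  have h1 : 0 ≤ 1 - ε := by linarith
  unfold selProb
  split_ifs with hU <;> try positivity
  all_goals
    have h2 : 0 ≤ 1 - κ * ε ^ (U i a0 - U i a1) :=
      sub_nonneg.2 (mul_rpow_lt_one hκ0 hκ hε0 hε (by linarith [not_le.1 hU])).le
    positivity

/-- Staying put and every constraint-feasible move have positive probability. -/
theorem selProb_pos (hκ0 : 0 < κ) (hκ : κ ≤ 1 / 2) (hε0 : 0 < ε) (hε : ε ≤ 1 / 2)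
    (a0 a1 : ∀ i, A i) (i : ι) (x : A i) (hx : x = a1 i ∨ x ∈ C i (a1 i)) :
    0 < selProb κ U C ε a0 a1 i x := by
  have h1 : 0 < 1 - ε := by linarith
  have hcard {s : Finset (A i)} (hs : x ∈ s) : 0 < ε / (s.card : ℝ) :=
    div_pos hε0 (by exact_mod_cast Finset.card_pos.2 ⟨x, hs⟩)
  unfold selProb
  by_cases hU : U i a0 ≤ U i a1
  · rw [if_pos hU]
    by_cases hx1 : x = a1 i
    · rw [if_pos hx1, if_neg (fun h => (Finset.mem_erase.1 h).1 hx1)]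
      linarith
    · have hm : x ∈ (C i (a1 i)).erase (a1 i) := Finset.mem_erase.2 ⟨hx1, hx.resolve_left hx1⟩
      rw [if_neg hx1, if_pos hm, zero_add]
      exact hcard hm
  · rw [if_neg hU]
    have h2 : 0 < 1 - κ * ε ^ (U i a0 - U i a1) :=
      sub_pos.2 (mul_rpow_lt_one hκ0 hκ hε0 hε (by linarith [not_le.1 hU]))
    by_cases hx0 : x = a0 i
    · rw [if_pos hx0]
      split_ifs <;> positivity
    by_cases hx1 : x = a1 i
    · rw [if_pos hx1, if_neg hx0]
      split_ifs <;> positivity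
    · have hm : x ∈ ((C i (a1 i)).erase (a1 i)).erase (a0 i) :=
        Finset.mem_erase.2 ⟨hx0, Finset.mem_erase.2 ⟨hx1, hx.resolve_left hx1⟩⟩
      rw [if_neg hx1, if_neg hx0, if_pos hm, zero_add, zero_add]
      exact hcard hm

theorem continuous_selProb (a0 a1 : ∀ i, A i) (i : ι) (x : A i) :
    Continuous fun ε : ℝ => selProb κ U C ε a0 a1 i x := by
  unfold selProb
  by_cases hU : U i a0 ≤ U i a1
  · simp only [if_pos hU]
    split_ifs <;> fun_prop
  · simp only [if_neg hU]
    have hc : Continuous fun ε : ℝ => ε ^ (U i a0 - U i a1) :=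
      Real.continuous_rpow_const (by linarith [not_le.1 hU])
    split_ifs <;> fun_prop

theorem exists_rpow_order_of_eq_mul {F G : ℝ → ℝ} {χ : ℝ} (hχ : 0 ≤ χ) (hG : Continuous G)
    (hG0 : 0 < G 0) (h : ∀ ε, 0 < ε → F ε = G ε * ε ^ χ) :
    ∃ χ : ℝ, 0 ≤ χ ∧ ∃ L : ℝ, 0 < L ∧
      Tendsto (fun ε : ℝ => F ε / ε ^ χ) (𝓝[>] (0 : ℝ)) (𝓝 L) := by
  refine ⟨χ, hχ, G 0, hG0, ?_⟩
  refine ((hG.tendsto 0).mono_left nhdsWithin_le_nhds).congr' ?_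
  filter_upwards [self_mem_nhdsWithin] with ε hε
  rw [h ε hε, mul_div_cancel_right₀ _ (Real.rpow_pos_of_pos hε χ).ne']

theorem selProb_exists_rpow_order (hκ0 : 0 < κ) (a0 a1 : ∀ i, A i) (i : ι) (x : A i)
    (hne : selProb κ U C ε a0 a1 i x ≠ 0) :
    ∃ χ : ℝ, 0 ≤ χ ∧ ∃ L : ℝ, 0 < L ∧
      Tendsto (fun ε : ℝ => selProb κ U C ε a0 a1 i x / ε ^ χ) (𝓝[>] (0 : ℝ)) (𝓝 L) := by
  have hcard {s : Finset (A i)} (hs : x ∈ s) : 0 < 1 / (s.card : ℝ) :=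
    div_pos one_pos (by exact_mod_cast Finset.card_pos.2 ⟨x, hs⟩)
  by_cases hU : U i a0 ≤ U i a1
  · by_cases hx1 : x = a1 i
    · refine exists_rpow_order_of_eq_mul le_rfl
        (continuous_selProb (κ := κ) (U := U) (C := C) a0 a1 i x) ?_
        fun t _ => by rw [Real.rpow_zero, mul_one]
      simp [selProb, hU, hx1]
    by_cases hm : x ∈ (C i (a1 i)).erase (a1 i)
    · refine exists_rpow_order_of_eq_mul zero_le_one continuous_const (hcard hm) fun t _ => ?_
      simp only [selProb, if_pos hU, if_neg hx1, if_pos hm, Real.rpow_one]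
      ring
    · exact absurd (by simp only [selProb, if_pos hU, if_neg hx1, if_neg hm, add_zero]) hne
  · have hδ : 0 < U i a0 - U i a1 := by linarith [not_le.1 hU]
    by_cases hx0 : x = a0 i
    · refine exists_rpow_order_of_eq_mul le_rfl
        (continuous_selProb (κ := κ) (U := U) (C := C) a0 a1 i x) ?_
        fun t _ => by rw [Real.rpow_zero, mul_one]
      simp [selProb, hU, hx0, Real.zero_rpow hδ.ne']
    by_cases hx1 : x = a1 i
    · refine exists_rpow_order_of_eq_mul (G := fun t => (1 - t) * κ) hδ.le (by fun_prop)
        (by simpa using hκ0) fun t _ => ?_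
      have hm : x ∉ ((C i (a1 i)).erase (a1 i)).erase (a0 i) := by simp [hx1]
      simp only [selProb, if_neg hU, if_pos hx1, if_neg hx0, if_neg hm]
      ring
    by_cases hm : x ∈ ((C i (a1 i)).erase (a1 i)).erase (a0 i)
    · refine exists_rpow_order_of_eq_mul zero_le_one continuous_const (hcard hm) fun t _ => ?_
      simp only [selProb, if_neg hU, if_neg hx1, if_neg hx0, if_pos hm, Real.rpow_one]
      ring
    · exact absurd
        (by simp only [selProb, if_neg hU, if_neg hx1, if_neg hx0, if_neg hm, add_zero]) hne

variable [Fintype ι]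

theorem exists_lazy_seq (hA1 : Assumption1 C) (a b : ∀ i, A i) :
    ∃ (N : ℕ) (g : ℕ → ∀ i, A i), g 0 = a ∧ (∀ n, N ≤ n → g n = b) ∧
      ∀ k i, g (k + 1) i = g k i ∨ g (k + 1) i ∈ C i (g k i) := by
  choose nf f hf0 hfn hf using fun i => hA1.2.1 i (a i) (b i)
  refine ⟨Finset.univ.sup nf, fun k i => f i (min k (nf i)), ?_, fun n hn => ?_, fun k i => ?_⟩
  · funext i
    simpa using hf0 i
  · funext i
    have hi : nf i ≤ n := (Finset.le_sup (Finset.mem_univ i)).trans hn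
    simpa [min_eq_right hi] using hfn i
  · rcases lt_or_ge k (nf i) with h | h
    · right
      simpa [min_eq_left h.le, min_eq_left (Nat.succ_le_of_lt h)] using hf i k h
    · left
      simp [min_eq_right h, min_eq_right (h.trans k.le_succ)]

theorem phTrans_nonneg (hκ0 : 0 < κ) (hκ : κ ≤ 1 / 2) (hε0 : 0 < ε) (hε : ε ≤ 1 / 2)
    (z w : (∀ i, A i) × (∀ i, A i)) : 0 ≤ phTrans κ U C ε z w := by
  unfold phTrans
  split_ifs
  · exact Finset.prod_nonneg fun i _ => selProb_nonneg hκ0 hκ hε0 hε _ _ _ _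
  · exact le_rfl

theorem phTrans_pos (hκ0 : 0 < κ) (hκ : κ ≤ 1 / 2) (hε0 : 0 < ε) (hε : ε ≤ 1 / 2)
    (p a b : ∀ i, A i) (h : ∀ i, b i = a i ∨ b i ∈ C i (a i)) :
    0 < phTrans κ U C ε (p, a) (a, b) := by
  unfold phTrans
  rw [if_pos rfl]
  exact Finset.prod_pos fun i _ => selProb_pos hκ0 hκ hε0 hε _ _ _ _ (h i)

theorem continuous_phTrans (z w : (∀ i, A i) × (∀ i, A i)) :
    Continuous fun ε : ℝ => phTrans κ U C ε z w := by
  unfold phTrans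
  split_ifs
  · exact continuous_finsetProd _ fun i _ => continuous_selProb _ _ _ _
  · exact continuous_const

theorem phTrans_exists_rpow_order (hκ0 : 0 < κ) (z w : (∀ i, A i) × (∀ i, A i))
    (hne : phTrans κ U C ε z w ≠ 0) :
    ∃ χ : ℝ, 0 ≤ χ ∧ ∃ L : ℝ, 0 < L ∧
      Tendsto (fun ε : ℝ => phTrans κ U C ε z w / ε ^ χ) (𝓝[>] (0 : ℝ)) (𝓝 L) := by
  unfold phTrans at hne ⊢
  split_ifs at hne ⊢
  · choose χ hχ L hL hlim using fun i =>
      selProb_exists_rpow_order hκ0 z.1 z.2 i (w.2 i)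
        (Finset.prod_ne_zero_iff.1 hne i (Finset.mem_univ i))
    refine ⟨∑ i, χ i, Finset.sum_nonneg fun i _ => hχ i, ∏ i, L i,
      Finset.prod_pos fun i _ => hL i, ?_⟩
    refine (tendsto_finsetProd Finset.univ fun i _ => hlim i).congr' ?_
    filter_upwards [self_mem_nhdsWithin] with t ht
    rw [Finset.prod_div_distrib, Real.rpow_sum_of_pos ht]
  · exact absurd rfl hne

variable [DecidableEq ι] [∀ i, Fintype (A i)]

theorem phTransPow_nonneg (hκ0 : 0 < κ) (hκ : κ ≤ 1 / 2) (hε0 : 0 < ε) (hε : ε ≤ 1 / 2)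
    (k : ℕ) (z w : (∀ i, A i) × (∀ i, A i)) : 0 ≤ phTransPow κ U C ε k z w := by
  induction k generalizing z with
  | zero => unfold phTransPow; split_ifs <;> norm_num
  | succ k ih =>
    unfold phTransPow
    exact Finset.sum_nonneg fun v _ => mul_nonneg (phTrans_nonneg hκ0 hκ hε0 hε _ _) (ih v)

theorem phTransPow_succ_pos (hκ0 : 0 < κ) (hκ : κ ≤ 1 / 2) (hε0 : 0 < ε) (hε : ε ≤ 1 / 2)
    {k : ℕ} {z v w : (∀ i, A i) × (∀ i, A i)} (h1 : 0 < phTrans κ U C ε z v)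
    (h2 : 0 < phTransPow κ U C ε k v w) : 0 < phTransPow κ U C ε (k + 1) z w := by
  unfold phTransPow
  exact Finset.sum_pos'
    (fun u _ => mul_nonneg (phTrans_nonneg hκ0 hκ hε0 hε _ _)
      (phTransPow_nonneg hκ0 hκ hε0 hε _ _ _))
    ⟨v, Finset.mem_univ v, mul_pos h1 h2⟩

/-- A sequence of lazy constraint-feasible moves is followed with positive probability. -/
theorem phTransPow_pos_of_seq (hκ0 : 0 < κ) (hκ : κ ≤ 1 / 2) (hε0 : 0 < ε) (hε : ε ≤ 1 / 2)
    (n : ℕ) (p q : ∀ i, A i) (g : ℕ → ∀ i, A i)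
    (hg : ∀ k i, g (k + 1) i = g k i ∨ g (k + 1) i ∈ C i (g k i))
    (hq : ∀ i, q i = g n i ∨ q i ∈ C i (g n i)) :
    0 < phTransPow κ U C ε (n + 1) (p, g 0) (g n, q) := by
  induction n generalizing p g with
  | zero =>
    refine phTransPow_succ_pos hκ0 hκ hε0 hε (phTrans_pos hκ0 hκ hε0 hε p (g 0) q hq) ?_
    simp [phTransPow]
  | succ n ih =>
    exact phTransPow_succ_pos hκ0 hκ hε0 hε (phTrans_pos hκ0 hκ hε0 hε p (g 0) (g 1) (hg 0))
      (ih (g 0) (fun k => g (k + 1)) (fun k => hg (k + 1)) hq)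

theorem exists_forall_ge_phTransPow_pos (hκ0 : 0 < κ) (hκ : κ ≤ 1 / 2) (hε0 : 0 < ε)
    (hε : ε ≤ 1 / 2) (hA1 : Assumption1 C) (z w : (∀ i, A i) × (∀ i, A i)) (hw : memB C w) :
    ∃ N, ∀ n, N ≤ n → 0 < phTransPow κ U C ε (n + 1) z w := by
  obtain ⟨N, g, hg0, hgN, hg⟩ := exists_lazy_seq hA1 z.2 w.1
  refine ⟨N, fun n hn => ?_⟩
  have h := phTransPow_pos_of_seq (U := U) hκ0 hκ hε0 hε n z.1 w.2 g hg
    (fun i => Or.inr (by rw [hgN n hn]; exact hw i))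
  rwa [hg0, hgN n hn] at h

end RegularPerturbation

section Theorems

variable {ι : Type*} [Fintype ι] [DecidableEq ι] {A : ι → Type*} [∀ i, Fintype (A i)]

theorem statement4
    (U : ι → (∀ i, A i) → ℝ) (C : ∀ i, A i → Finset (A i))
    (κ : ℝ) (hκ0 : 0 < κ) (hκ : κ ≤ 1 / 2) (hA1 : Assumption1 C) :
    (∀ ε : ℝ, 0 < ε → ε ≤ 1 / 2 →
      (∀ z z' : (∀ i, A i) × (∀ i, A i), memB C z → memB C z' →
        ∃ k : ℕ, 1 ≤ k ∧ 0 < phTransPow κ U C ε k z z') ∧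
      (∀ z : (∀ i, A i) × (∀ i, A i), memB C z →
        ∀ d : ℕ, (∀ k : ℕ, 0 < k → 0 < phTransPow κ U C ε k z z → d ∣ k) → d = 1)) ∧
    (∀ z1 z2 : (∀ i, A i) × (∀ i, A i),
      Tendsto (fun ε : ℝ => phTrans κ U C ε z1 z2) (𝓝[>] (0 : ℝ))
        (𝓝 (phTrans κ U C 0 z1 z2))) ∧
    (∀ z1 z2 : (∀ i, A i) × (∀ i, A i),
      (∃ ε : ℝ, 0 < ε ∧ ε ≤ 1 / 2 ∧ 0 < phTrans κ U C ε z1 z2) →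
      ∃ χ : ℝ, 0 ≤ χ ∧ ∃ L : ℝ, 0 < L ∧
        Tendsto (fun ε : ℝ => phTrans κ U C ε z1 z2 / ε ^ χ) (𝓝[>] (0 : ℝ)) (𝓝 L)) := by
  refine ⟨fun ε hε0 hε => ⟨fun z z' _ hz' => ?_, fun z hz d hd => ?_⟩, fun z1 z2 => ?_,
    fun z1 z2 ⟨ε, _, _, hpos⟩ => phTrans_exists_rpow_order hκ0 z1 z2 hpos.ne'⟩
  · obtain ⟨N, hN⟩ :=
      exists_forall_ge_phTransPow_pos (U := U) hκ0 hκ hε0 hε hA1 z z' hz'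
    exact ⟨N + 1, N.succ_pos, hN N le_rfl⟩
  · obtain ⟨N, hN⟩ := exists_forall_ge_phTransPow_pos (U := U) hκ0 hκ hε0 hε hA1 z z hz
    have h1 := hd (N + 1) N.succ_pos (hN N le_rfl)
    have h2 := hd (N + 1 + 1) (N + 1).succ_pos (hN (N + 1) N.le_succ)
    exact Nat.dvd_one.1 ((Nat.dvd_add_right h1).1 h2)
  · exact ((continuous_phTrans z1 z2).tendsto 0).mono_left nhdsWithin_le_nhds

end Theorems
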